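/- Let q* be a joint distribution attaining Ω^{(μ,λ)}(P). Along the iteration q^{[t+1]}(x,y) = exp(−ω_{q^{[t]}}^{(μ,λ)}(x,y)) q^{[t]}(x,y) / Λ_{q^{[t]}}^{(μ,λ)} started from a joint distribution q^{[1]} with all components positive, for every T ≥ 1: 0 ≤ −log Λ_{q^{[T]}}^{(μ,λ)} − Ω^{(μ,λ)}(P) ≤ D(q*||q^{[1]}) / T. -/

import Mathlib

open Real Filter

noncomputable section

def IsDist {X : Type*} [Fintype X] (P : X → ℝ) : Prop :=
  (∀ x, 0 ≤ P x) ∧ ∑ x, P x = 1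

def IsJoint {X Y : Type*} [Fintype X] [Fintype Y] (q : X → Y → ℝ) : Prop :=
  (∀ x y, 0 ≤ q x y) ∧ ∑ x, ∑ y, q x y = 1

def IsCond {X Y : Type*} [Fintype X] [Fintype Y] (V : X → Y → ℝ) : Prop :=
  (∀ x y, 0 ≤ V x y) ∧ ∀ x, ∑ y, V x y = 1

def margX {X Y : Type*} [Fintype Y] (q : X → Y → ℝ) (x : X) : ℝ := ∑ y, q x y

def margY {X Y : Type*} [Fintype X] (q : X → Y → ℝ) (y : Y) : ℝ := ∑ x, q x y

/-- conditional distribution of `X` given `Y` : `q_{X|Y}(x|y)` -/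
def condXY {X Y : Type*} [Fintype X] (q : X → Y → ℝ) (x : X) (y : Y) : ℝ :=
  q x y / margY q y

/-- conditional distribution of `Y` given `X` : `q_{Y|X}(y|x)` -/
def condYX {X Y : Type*} [Fintype Y] (q : X → Y → ℝ) (x : X) (y : Y) : ℝ :=
  q x y / margX q x

/-- mutual information `I(q_X, q_{Y|X})` of a joint distribution `q` -/
def mutInfo {X Y : Type*} [Fintype X] [Fintype Y] (q : X → Y → ℝ) : ℝ :=
  ∑ x, ∑ y, q x y * Real.log (q x y / (margX q x * margY q y))

/-- divergence `D(q_X ‖ P)` -/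
def klX {X Y : Type*} [Fintype X] [Fintype Y] (q : X → Y → ℝ) (P : X → ℝ) : ℝ :=
  ∑ x, margX q x * Real.log (margX q x / P x)

/-- divergence `D(p ‖ q)` of distributions on `X` -/
def klD {X : Type*} [Fintype X] (p q : X → ℝ) : ℝ :=
  ∑ x, p x * Real.log (p x / q x)

/-- divergence `D(q ‖ p)` of joint distributions -/
def klJoint {X Y : Type*} [Fintype X] [Fintype Y] (q p : X → Y → ℝ) : ℝ :=
  ∑ x, ∑ y, q x y * Real.log (q x y / p x y)

/-- expected distortion `E_q[d(X,Y)]` -/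
def Ed {X Y : Type*} [Fintype X] [Fintype Y] (q d : X → Y → ℝ) : ℝ :=
  ∑ x, ∑ y, q x y * d x y

/-- `G(R,Δ|P)` -/
def G {X Y : Type*} [Fintype X] [Fintype Y] (P : X → ℝ) (d : X → Y → ℝ) (R Δ : ℝ) : ℝ :=
  sInf {v : ℝ | ∃ q : X → Y → ℝ, IsJoint q ∧ Ed q d ≤ Δ ∧
    v = max 0 (mutInfo q - R) + klX q P}

/-- `G^{(λ)}(R,Δ|P)` -/
def Glam {X Y : Type*} [Fintype X] [Fintype Y] (P : X → ℝ) (d : X → Y → ℝ)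
    (lam R Δ : ℝ) : ℝ :=
  sInf {v : ℝ | ∃ q : X → Y → ℝ, IsJoint q ∧ Ed q d ≤ Δ ∧
    v = lam * (mutInfo q - R) + klX q P}

/-- rate distortion function `R(Δ|P)` -/
def RD {X Y : Type*} [Fintype X] [Fintype Y] (P : X → ℝ) (d : X → Y → ℝ) (Δ : ℝ) : ℝ :=
  sInf {v : ℝ | ∃ V : X → Y → ℝ, IsCond V ∧ Ed (fun x y => P x * V x y) d ≤ Δ ∧
    v = mutInfo (fun x y => P x * V x y)}

/-- `Ω^{(μ,λ)}(P)` -/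
def OmegaF {X Y : Type*} [Fintype X] [Fintype Y] (P : X → ℝ) (d : X → Y → ℝ)
    (μ lam : ℝ) : ℝ :=
  sInf {v : ℝ | ∃ q : X → Y → ℝ, IsJoint q ∧
    v = lam * mutInfo q + klX q P + μ * Ed q d}

/-- `G^{(μ,λ)}(R,Δ|P) = Ω^{(μ,λ)}(P) − λR − μΔ` -/
def Gmulam {X Y : Type*} [Fintype X] [Fintype Y] (P : X → ℝ) (d : X → Y → ℝ)
    (μ lam R Δ : ℝ) : ℝ :=
  OmegaF P d μ lam - lam * R - μ * Δ

/-- `ω_q^{(μ,λ)}(x,y)` -/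
def omg {X Y : Type*} [Fintype X] [Fintype Y] (P : X → ℝ) (d : X → Y → ℝ)
    (μ lam : ℝ) (q : X → Y → ℝ) (x : X) (y : Y) : ℝ :=
  Real.log (margX q x ^ (1 - lam) * condXY q x y ^ lam * Real.exp (μ * d x y) / P x)

/-- `F^{(μ,λ)}(p,q) = E_q[ω_p^{(μ,λ)}(X,Y)] + D(q‖p)` -/
def Ffun {X Y : Type*} [Fintype X] [Fintype Y] (P : X → ℝ) (d : X → Y → ℝ)
    (μ lam : ℝ) (p q : X → Y → ℝ) : ℝ :=
  (∑ x, ∑ y, q x y * omg P d μ lam p x y) + klJoint q p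

/-- `Λ_p^{(μ,λ)} = E_p[exp(−ω_p^{(μ,λ)}(X,Y))]` -/
def Lam {X Y : Type*} [Fintype X] [Fintype Y] (P : X → ℝ) (d : X → Y → ℝ)
    (μ lam : ℝ) (p : X → Y → ℝ) : ℝ :=
  ∑ x, ∑ y, p x y * Real.exp (-(omg P d μ lam p x y))

/-- cutoff rate `R_cut^{(λ)}(Δ|P)` -/
def Rcut {X Y : Type*} [Fintype X] [Fintype Y] (P : X → ℝ) (d : X → Y → ℝ)
    (lam Δ : ℝ) : ℝ :=
  sInf {v : ℝ | ∃ q : X → Y → ℝ, IsJoint q ∧ Ed q d ≤ Δ ∧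
    v = mutInfo q + (1 / lam) * klX q P}

/-- Shannon entropy -/
def entropy {X : Type*} [Fintype X] (p : X → ℝ) : ℝ :=
  -∑ x, p x * Real.log (p x)

section Marginals

variable {X Y : Type*}

section

variable [Fintype Y]

theorem le_margX {q : X → Y → ℝ} (hq : ∀ x y, 0 ≤ q x y) (x : X) (y : Y) :
    q x y ≤ margX q x :=
  Finset.single_le_sum (f := fun y => q x y) (fun y _ => hq x y) (Finset.mem_univ y)

theorem margX_nonneg {q : X → Y → ℝ} (hq : ∀ x y, 0 ≤ q x y) (x : X) : 0 ≤ margX q x :=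
  Finset.sum_nonneg fun y _ => hq x y

theorem eq_zero_of_margX_eq_zero {q : X → Y → ℝ} (hq : ∀ x y, 0 ≤ q x y) {x : X}
    (h : margX q x = 0) (y : Y) : q x y = 0 :=
  le_antisymm (h ▸ le_margX hq x y) (hq x y)

theorem margX_pos {p : X → Y → ℝ} (hp : ∀ x y, 0 < p x y) (x : X) (y : Y) : 0 < margX p x :=
  (hp x y).trans_le (le_margX (fun x y => (hp x y).le) x y)

end

section

variable [Fintype X]

theorem le_margY {q : X → Y → ℝ} (hq : ∀ x y, 0 ≤ q x y) (x : X) (y : Y) :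
    q x y ≤ margY q y :=
  Finset.single_le_sum (f := fun x => q x y) (fun x _ => hq x y) (Finset.mem_univ x)

theorem margY_nonneg {q : X → Y → ℝ} (hq : ∀ x y, 0 ≤ q x y) (y : Y) : 0 ≤ margY q y :=
  Finset.sum_nonneg fun x _ => hq x y

theorem eq_zero_of_margY_eq_zero {q : X → Y → ℝ} (hq : ∀ x y, 0 ≤ q x y) {y : Y}
    (h : margY q y = 0) (x : X) : q x y = 0 :=
  le_antisymm (h ▸ le_margY hq x y) (hq x y)

theorem margY_pos {p : X → Y → ℝ} (hp : ∀ x y, 0 < p x y) (x : X) (y : Y) : 0 < margY p y :=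
  (hp x y).trans_le (le_margY (fun x y => (hp x y).le) x y)

end

end Marginals

section Divergence

variable {X Y : Type*} [Fintype X] [Fintype Y]

/-- Gibbs' inequality for a distribution and a subdistribution. -/
theorem klD_nonneg_of_sum_le {a b : X → ℝ} (ha : ∀ x, 0 ≤ a x) (hb : ∀ x, 0 ≤ b x)
    (hab : ∀ x, b x = 0 → a x = 0) (hsum : ∑ x, b x ≤ ∑ x, a x) : 0 ≤ klD a b := by
  have key : ∀ x, a x - b x ≤ a x * Real.log (a x / b x) := by
    intro x
    rcases (ha x).eq_or_lt with h | h
    · simp [← h, hb x]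
    · have hbx : 0 < b x := (hb x).lt_of_ne fun h0 => h.ne' (hab x h0.symm)
      have h1 := mul_le_mul_of_nonneg_left (Real.one_sub_inv_le_log_of_pos (div_pos h hbx)) h.le
      have h2 : a x * (1 - (a x / b x)⁻¹) = a x - b x := by field_simp
      linarith
  have h := Finset.sum_le_sum fun x (_ : x ∈ Finset.univ) => key x
  rw [Finset.sum_sub_distrib] at h
  unfold klD
  linarith

theorem klJoint_nonneg_of_sum_le {q p : X → Y → ℝ} (hq : ∀ x y, 0 ≤ q x y)
    (hp : ∀ x y, 0 ≤ p x y) (hqp : ∀ x y, p x y = 0 → q x y = 0)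
    (hsum : ∑ x, ∑ y, p x y ≤ ∑ x, ∑ y, q x y) : 0 ≤ klJoint q p := by
  have h := klD_nonneg_of_sum_le (a := fun z : X × Y => q z.1 z.2) (b := fun z => p z.1 z.2)
    (fun z => hq _ _) (fun z => hp _ _) (fun z => hqp _ _)
    (by simpa only [Fintype.sum_prod_type] using hsum)
  simpa only [klD, klJoint, Fintype.sum_prod_type] using h

theorem sum_margX (q : X → Y → ℝ) : ∑ x, margX q x = ∑ x, ∑ y, q x y := rfl

theorem sum_margY (q : X → Y → ℝ) : ∑ y, margY q y = ∑ x, ∑ y, q x y :=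
  Finset.sum_comm

theorem klX_eq_sum (q : X → Y → ℝ) (P : X → ℝ) :
    klX q P = ∑ x, ∑ y, q x y * Real.log (margX q x / P x) := by
  simp only [klX, margX, Finset.sum_mul]

theorem klD_margY_eq_sum (q : X → Y → ℝ) (R : Y → ℝ) :
    klD (margY q) R = ∑ x, ∑ y, q x y * Real.log (margY q y / R y) := by
  rw [Finset.sum_comm]
  simp only [klD, margY, Finset.sum_mul]

theorem mutInfo_nonneg {q : X → Y → ℝ} (hq : IsJoint q) : 0 ≤ mutInfo q := by
  refine klJoint_nonneg_of_sum_le (p := fun x y => margX q x * margY q y) hq.1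
    (fun x y => mul_nonneg (margX_nonneg hq.1 x) (margY_nonneg hq.1 y)) ?_ ?_
  · intro x y h
    rcases mul_eq_zero.1 h with h | h
    · exact eq_zero_of_margX_eq_zero hq.1 h y
    · exact eq_zero_of_margY_eq_zero hq.1 h x
  · simp only [← Finset.mul_sum, sum_margX, sum_margY, hq.2, mul_one, le_refl]

theorem klX_nonneg {q : X → Y → ℝ} (hq : IsJoint q) {P : X → ℝ} (hP : IsDist P)
    (hPpos : ∀ x, 0 < P x) : 0 ≤ klX q P :=
  klD_nonneg_of_sum_le (margX_nonneg hq.1) hP.1 (fun x h => absurd h (hPpos x).ne')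
    (by rw [hP.2, sum_margX, hq.2])

theorem OmegaF_le {P : X → ℝ} (hP : IsDist P) (hPpos : ∀ x, 0 < P x) {d : X → Y → ℝ}
    (hd : ∀ x y, 0 ≤ d x y) {μ lam : ℝ} (hμ : 0 ≤ μ) (hlam0 : 0 ≤ lam) {q : X → Y → ℝ}
    (hq : IsJoint q) : OmegaF P d μ lam ≤ lam * mutInfo q + klX q P + μ * Ed q d := by
  refine csInf_le ⟨0, ?_⟩ ⟨q, hq, rfl⟩
  rintro v ⟨r, hr, rfl⟩
  have h1 := mul_nonneg hlam0 (mutInfo_nonneg hr)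
  have h2 := klX_nonneg hr hP hPpos
  have h3 : 0 ≤ μ * Ed r d :=
    mul_nonneg hμ (Finset.sum_nonneg fun x _ => Finset.sum_nonneg fun y _ =>
      mul_nonneg (hr.1 x y) (hd x y))
  linarith

section Pos

variable {p q : X → Y → ℝ}

theorem nonempty_of_isJoint (hp : IsJoint p) : Nonempty X ∧ Nonempty Y := by
  constructor <;> by_contra h <;> rw [not_nonempty_iff] at h <;> simpa using hp.2

theorem klX_margX_nonneg (hp : IsJoint p) (hpos : ∀ x y, 0 < p x y) (hq : IsJoint q) :
    0 ≤ klX q (margX p) := by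
  obtain ⟨-, ⟨y⟩⟩ := nonempty_of_isJoint hp
  exact klX_nonneg hq ⟨margX_nonneg hp.1, hp.2⟩ fun x => margX_pos hpos x y

theorem klD_margY_nonneg (hp : IsJoint p) (hpos : ∀ x y, 0 < p x y) (hq : IsJoint q) :
    0 ≤ klD (margY q) (margY p) := by
  obtain ⟨⟨x⟩, -⟩ := nonempty_of_isJoint hp
  exact klD_nonneg_of_sum_le (margY_nonneg hq.1) (margY_nonneg hp.1)
    (fun y h => absurd h (margY_pos hpos x y).ne') (by rw [sum_margY, sum_margY, hp.2, hq.2])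

/-- The conditional divergence `D(q_{Y|X} ‖ p_{Y|X} | q_X)` is nonnegative. -/
theorem klJoint_condYX_nonneg (hp : IsJoint p) (hpos : ∀ x y, 0 < p x y) (hq : IsJoint q) :
    0 ≤ klJoint q (fun x y => margX q x * condYX p x y) := by
  obtain ⟨-, ⟨y₀⟩⟩ := nonempty_of_isJoint hp
  refine klJoint_nonneg_of_sum_le hq.1 (fun x y => mul_nonneg (margX_nonneg hq.1 x)
    (div_nonneg (hp.1 x y) (margX_nonneg hp.1 x))) ?_ ?_
  · intro x y h
    rcases mul_eq_zero.1 h with h | h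
    · exact eq_zero_of_margX_eq_zero hq.1 h y
    · exact absurd h (div_pos (hpos x y) (margX_pos hpos x y)).ne'
  · refine (Finset.sum_congr rfl fun x _ => ?_).le
    simp only [condYX, ← Finset.mul_sum, ← Finset.sum_div]
    change margX q x * (margX p x / margX p x) = margX q x
    rw [div_self (margX_pos hpos x y₀).ne', mul_one]

/-- The conditional divergence `D(q_{X|Y} ‖ p_{X|Y} | q_Y)` is nonnegative. -/
theorem klJoint_condXY_nonneg (hp : IsJoint p) (hpos : ∀ x y, 0 < p x y) (hq : IsJoint q) :
    0 ≤ klJoint q (fun x y => margY q y * condXY p x y) := by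
  obtain ⟨⟨x₀⟩, -⟩ := nonempty_of_isJoint hp
  refine klJoint_nonneg_of_sum_le hq.1 (fun x y => mul_nonneg (margY_nonneg hq.1 y)
    (div_nonneg (hp.1 x y) (margY_nonneg hp.1 y))) ?_ ?_
  · intro x y h
    rcases mul_eq_zero.1 h with h | h
    · exact eq_zero_of_margY_eq_zero hq.1 h x
    · exact absurd h (div_pos (hpos x y) (margY_pos hpos x y)).ne'
  · rw [Finset.sum_comm, Finset.sum_comm (f := q)]
    refine (Finset.sum_congr rfl fun y _ => ?_).le
    simp only [condXY, ← Finset.mul_sum, ← Finset.sum_div]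
    change margY q y * (margY p y / margY p y) = margY q y
    rw [div_self (margY_pos hpos x₀ y).ne', mul_one]

end Pos

section Iteration

variable {P : X → ℝ} {d : X → Y → ℝ} {μ lam : ℝ} {p q : X → Y → ℝ}

theorem omg_eq (hPpos : ∀ x, 0 < P x) (hpos : ∀ x y, 0 < p x y) (x : X) (y : Y) :
    omg P d μ lam p x y = (1 - lam) * Real.log (margX p x) +
      lam * (Real.log (p x y) - Real.log (margY p y)) + μ * d x y - Real.log (P x) := by
  have hX := margX_pos hpos x y
  have hY := margY_pos hpos x y
  have hc : 0 < condXY p x y := div_pos (hpos x y) hY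
  have h1 := Real.rpow_pos_of_pos hX (1 - lam)
  have h2 := Real.rpow_pos_of_pos hc lam
  rw [omg, Real.log_div (mul_pos (mul_pos h1 h2) (Real.exp_pos _)).ne' (hPpos x).ne',
    Real.log_mul (mul_pos h1 h2).ne' (Real.exp_pos _).ne', Real.log_mul h1.ne' h2.ne',
    Real.log_rpow hX, Real.log_rpow hc, Real.log_exp, condXY,
    Real.log_div (hpos x y).ne' hY.ne']

theorem Ffun_eq_add (hPpos : ∀ x, 0 < P x) (hpos : ∀ x y, 0 < p x y) (hq : IsJoint q) :
    Ffun P d μ lam p q = lam * mutInfo q + klX q P + μ * Ed q d +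
      ((1 - lam) * klJoint q (fun x y => margX q x * condYX p x y) +
        lam * klD (margY q) (margY p)) := by
  rw [Ffun, klX_eq_sum, klD_margY_eq_sum]
  simp only [klJoint, mutInfo, Ed, Finset.mul_sum, ← Finset.sum_add_distrib]
  refine Finset.sum_congr rfl fun x _ => Finset.sum_congr rfl fun y _ => ?_
  rcases (hq.1 x y).eq_or_lt with h | h
  · simp [← h]
  have hX := h.trans_le (le_margX hq.1 x y)
  have hY := h.trans_le (le_margY hq.1 x y)
  have hpX := margX_pos hpos x y
  have hpY := margY_pos hpos x y
  have hp := hpos x y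
  rw [omg_eq hPpos hpos, condYX, Real.log_div h.ne' hp.ne', Real.log_div h.ne' (by positivity),
    Real.log_div hX.ne' (hPpos x).ne', Real.log_div h.ne' (by positivity),
    Real.log_div hY.ne' hpY.ne', Real.log_mul hX.ne' hY.ne', Real.log_mul hX.ne' (by positivity),
    Real.log_div hp.ne' hpX.ne']
  ring

theorem Ffun_eq_sub (hPpos : ∀ x, 0 < P x) (hpos : ∀ x y, 0 < p x y) (hq : IsJoint q) :
    Ffun P d μ lam p q = lam * mutInfo q + klX q P + μ * Ed q d + klJoint q p -
      ((1 - lam) * klX q (margX p) +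
        lam * klJoint q (fun x y => margY q y * condXY p x y)) := by
  rw [Ffun, klX_eq_sum, klX_eq_sum]
  simp only [klJoint, mutInfo, Ed, Finset.mul_sum, ← Finset.sum_add_distrib,
    ← Finset.sum_sub_distrib]
  refine Finset.sum_congr rfl fun x _ => Finset.sum_congr rfl fun y _ => ?_
  rcases (hq.1 x y).eq_or_lt with h | h
  · simp [← h]
  have hX := h.trans_le (le_margX hq.1 x y)
  have hY := h.trans_le (le_margY hq.1 x y)
  have hpX := margX_pos hpos x y
  have hpY := margY_pos hpos x y
  have hp := hpos x y
  rw [omg_eq hPpos hpos, condXY, Real.log_div h.ne' hp.ne', Real.log_div h.ne' (by positivity),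
    Real.log_div hX.ne' (hPpos x).ne', Real.log_div hX.ne' hpX.ne',
    Real.log_div h.ne' (by positivity), Real.log_mul hX.ne' hY.ne',
    Real.log_mul hY.ne' (by positivity), Real.log_div hp.ne' hpY.ne']
  ring

theorem le_Ffun (hlam0 : 0 ≤ lam) (hlam1 : lam ≤ 1) (hPpos : ∀ x, 0 < P x) (hp : IsJoint p)
    (hpos : ∀ x y, 0 < p x y) (hq : IsJoint q) :
    lam * mutInfo q + klX q P + μ * Ed q d ≤ Ffun P d μ lam p q := by
  rw [Ffun_eq_add hPpos hpos hq]
  exact le_add_of_nonneg_right <| add_nonneg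
    (mul_nonneg (sub_nonneg.2 hlam1) (klJoint_condYX_nonneg hp hpos hq))
    (mul_nonneg hlam0 (klD_margY_nonneg hp hpos hq))

theorem Ffun_le (hlam0 : 0 ≤ lam) (hlam1 : lam ≤ 1) (hPpos : ∀ x, 0 < P x) (hp : IsJoint p)
    (hpos : ∀ x y, 0 < p x y) (hq : IsJoint q) :
    Ffun P d μ lam p q ≤ lam * mutInfo q + klX q P + μ * Ed q d + klJoint q p := by
  rw [Ffun_eq_sub hPpos hpos hq]
  exact sub_le_self _ <| add_nonneg
    (mul_nonneg (sub_nonneg.2 hlam1) (klX_margX_nonneg hp hpos hq))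
    (mul_nonneg hlam0 (klJoint_condXY_nonneg hp hpos hq))

theorem klJoint_self (hpos : ∀ x y, 0 < p x y) : klJoint p p = 0 := by
  simp [klJoint, (hpos _ _).ne']

theorem Lam_pos (hp : IsJoint p) (hpos : ∀ x y, 0 < p x y) : 0 < Lam P d μ lam p := by
  obtain ⟨_, _⟩ := nonempty_of_isJoint hp
  exact Finset.sum_pos (fun x _ => Finset.sum_pos
    (fun y _ => mul_pos (hpos x y) (Real.exp_pos _)) Finset.univ_nonempty) Finset.univ_nonempty

theorem tilt_pos (hp : IsJoint p) (hpos : ∀ x y, 0 < p x y) (x : X) (y : Y) :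
    0 < Real.exp (-(omg P d μ lam p x y)) * p x y / Lam P d μ lam p :=
  div_pos (mul_pos (Real.exp_pos _) (hpos x y)) (Lam_pos hp hpos)

theorem isJoint_tilt (hp : IsJoint p) (hpos : ∀ x y, 0 < p x y) :
    IsJoint fun x y => Real.exp (-(omg P d μ lam p x y)) * p x y / Lam P d μ lam p := by
  refine ⟨fun x y => (tilt_pos hp hpos x y).le, ?_⟩
  simp only [← Finset.sum_div, mul_comm (Real.exp _)]
  exact div_self (Lam_pos hp hpos).ne'

theorem Ffun_eq_klJoint_tilt (hp : IsJoint p) (hpos : ∀ x y, 0 < p x y) (hq : IsJoint q) :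
    Ffun P d μ lam p q = klJoint q
      (fun x y => Real.exp (-(omg P d μ lam p x y)) * p x y / Lam P d μ lam p) -
        Real.log (Lam P d μ lam p) := by
  have hL := Lam_pos (P := P) (d := d) (μ := μ) (lam := lam) hp hpos
  have h1 : Real.log (Lam P d μ lam p) =
      ∑ x, ∑ y, q x y * Real.log (Lam P d μ lam p) := by
    simp only [← Finset.sum_mul, hq.2, one_mul]
  rw [h1, Ffun]
  simp only [klJoint, ← Finset.sum_add_distrib, ← Finset.sum_sub_distrib]
  refine Finset.sum_congr rfl fun x _ => Finset.sum_congr rfl fun y _ => ?_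
  rcases (hq.1 x y).eq_or_lt with h | h
  · simp [← h]
  have hpxy := hpos x y
  rw [Real.log_div h.ne' hpxy.ne', Real.log_div h.ne' (tilt_pos hp hpos x y).ne',
    Real.log_div (by positivity) hL.ne', Real.log_mul (Real.exp_pos _).ne' hpxy.ne',
    Real.log_exp]
  ring

end Iteration

end Divergence

/-- with `q*` attaining `Ω^{(μ,λ)}(P)`, along the iteration, for
every `T ≥ 1`, `0 ≤ −log Λ_{q^{[T]}} − Ω^{(μ,λ)}(P) ≤ D(q*‖q^{[1]}) / T`. -/
theorem stmt14 {X Y : Type*} [Fintype X] [Fintype Y]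
    (P : X → ℝ) (hP : IsDist P) (hPpos : ∀ x, 0 < P x)
    (d : X → Y → ℝ) (hd : ∀ x y, 0 ≤ d x y)
    (μ lam : ℝ) (hμ : 0 ≤ μ) (hlam0 : 0 ≤ lam) (hlam1 : lam ≤ 1)
    (qstar : X → Y → ℝ) (hqstar : IsJoint qstar)
    (hqstaropt : lam * mutInfo qstar + klX qstar P + μ * Ed qstar d =
      OmegaF P d μ lam)
    (qseq : ℕ → X → Y → ℝ)
    (hinit : IsJoint (qseq 1)) (hinitpos : ∀ x y, 0 < qseq 1 x y)
    (hstep : ∀ t : ℕ, 1 ≤ t → ∀ x y,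
      qseq (t + 1) x y =
        Real.exp (-(omg P d μ lam (qseq t) x y)) * qseq t x y /
          Lam P d μ lam (qseq t)) :
    ∀ T : ℕ, 1 ≤ T →
      0 ≤ -Real.log (Lam P d μ lam (qseq T)) - OmegaF P d μ lam ∧
      -Real.log (Lam P d μ lam (qseq T)) - OmegaF P d μ lam ≤
        klJoint qstar (qseq 1) / (T : ℝ) := by
  have hnext : ∀ t, 1 ≤ t → qseq (t + 1) = fun x y =>
      Real.exp (-(omg P d μ lam (qseq t) x y)) * qseq t x y / Lam P d μ lam (qseq t) :=
    fun t ht => funext₂ (hstep t ht)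
  have hseq : ∀ t, 1 ≤ t → IsJoint (qseq t) ∧ ∀ x y, 0 < qseq t x y := by
    intro t ht
    induction t, ht using Nat.le_induction with
    | base => exact ⟨hinit, hinitpos⟩
    | succ t ht ih =>
      rw [hnext t ht]
      exact ⟨isJoint_tilt ih.1 ih.2, tilt_pos ih.1 ih.2⟩
  have hF : ∀ t, 1 ≤ t → ∀ q, IsJoint q → Ffun P d μ lam (qseq t) q =
      klJoint q (qseq (t + 1)) - Real.log (Lam P d μ lam (qseq t)) := by
    intro t ht q hq
    rw [hnext t ht]
    exact Ffun_eq_klJoint_tilt (hseq t ht).1 (hseq t ht).2 hq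
  have hkl : ∀ t, 1 ≤ t → ∀ q, IsJoint q → 0 ≤ klJoint q (qseq t) := fun t ht q hq =>
    klJoint_nonneg_of_sum_le hq.1 (hseq t ht).1.1
      (fun x y h => absurd h ((hseq t ht).2 x y).ne') (by rw [hq.2, (hseq t ht).1.2])
  have hobj : ∀ t, 1 ≤ t → lam * mutInfo (qseq (t + 1)) + klX (qseq (t + 1)) P +
      μ * Ed (qseq (t + 1)) d ≤ -Real.log (Lam P d μ lam (qseq t)) := by
    intro t ht
    obtain ⟨hj, hpos⟩ := hseq (t + 1) (by omega)
    have h := le_Ffun (d := d) (μ := μ) hlam0 hlam1 hPpos (hseq t ht).1 (hseq t ht).2 hj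
    rw [hF t ht _ hj, klJoint_self hpos] at h
    linarith
  have hanti : ∀ t, 1 ≤ t → -Real.log (Lam P d μ lam (qseq (t + 1))) ≤
      -Real.log (Lam P d μ lam (qseq t)) := by
    intro t ht
    obtain ⟨hj, hpos⟩ := hseq (t + 1) (by omega)
    have h1 := Ffun_le (d := d) (μ := μ) hlam0 hlam1 hPpos hj hpos hj
    rw [hF (t + 1) (by omega) _ hj, klJoint_self hpos] at h1
    have h2 := hkl (t + 1 + 1) (by omega) _ hj
    linarith [hobj t ht]
  have hgap : ∀ t, 1 ≤ t → -Real.log (Lam P d μ lam (qseq t)) - OmegaF P d μ lam ≤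
      klJoint qstar (qseq t) - klJoint qstar (qseq (t + 1)) := by
    intro t ht
    have h := Ffun_le (d := d) (μ := μ) hlam0 hlam1 hPpos (hseq t ht).1 (hseq t ht).2 hqstar
    rw [hF t ht _ hqstar, hqstaropt] at h
    linarith
  have hsum : ∀ T : ℕ, 1 ≤ T →
      (-Real.log (Lam P d μ lam (qseq T)) - OmegaF P d μ lam) * (T : ℝ) ≤
        klJoint qstar (qseq 1) - klJoint qstar (qseq (T + 1)) := by
    intro T hT
    induction T, hT using Nat.le_induction with
    | base => simpa using hgap 1 le_rfl
    | succ T hT ih =>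
      have h1 := mul_le_mul_of_nonneg_right (hanti T hT) (Nat.cast_nonneg (α := ℝ) T)
      have h2 := hgap (T + 1) (by omega)
      push_cast
      linarith
  intro T hT
  constructor
  · have h := OmegaF_le hP hPpos hd hμ hlam0 (hseq (T + 1) (by omega)).1
    linarith [hobj T hT]
  · rw [le_div_iff₀ (by exact_mod_cast hT)]
    linarith [hsum T hT, hkl (T + 1) (by omega) qstar hqstar]
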